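/- Let K be a field and let μ_1 and μ_2 be partitions of n. If there exists a partition λ of n which has both μ_1 and μ_2 as almost rectangular refinements, then the nilpotent similarity classes N(μ_1) and N(μ_2) commute over K. -/

import Mathlib

open Polynomial Matrix

/-- Two square matrices over a commutative ring are *similar* if they are
conjugate by an invertible matrix. -/
def SimilarMat {m : Type*} [Fintype m] [DecidableEq m] {K : Type*} [CommRing K]
    (A B : Matrix m m K) : Prop :=
  ∃ P : (Matrix m m K)ˣ, B = (↑P : Matrix m m K) * A * (↑P⁻¹ : Matrix m m K)

/-- The nilpotent Jordan block of size `p` (eigenvalue `0`). -/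
def jordanBlock (K : Type*) [Zero K] [One K] (p : ℕ) : Matrix (Fin p) (Fin p) K :=
  Matrix.of fun i j => if (i : ℕ) + 1 = (j : ℕ) then 1 else 0

/-- `M` is a nilpotent matrix whose Jordan block sizes are the parts of the
partition `mu`; that is, `M` is similar to the direct sum of the nilpotent
Jordan blocks whose sizes are the parts of `mu`. -/
def HasJordanPartition {K : Type*} [Field K] {n : ℕ}
    (M : Matrix (Fin n) (Fin n) K) (mu : Nat.Partition n) : Prop :=
  ∃ L : List ℕ, (↑L : Multiset ℕ) = mu.parts ∧
    ∃ e : ((i : Fin L.length) × Fin (L.get i)) ≃ Fin n,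
      SimilarMat (Matrix.reindex e e (Matrix.blockDiagonal' fun i => jordanBlock K (L.get i))) M

/-- A multiset of naturals is almost rectangular if its largest element
exceeds its smallest element by at most `1`. -/
def AlmostRectangular (s : Multiset ℕ) : Prop := ∀ a ∈ s, ∀ b ∈ s, a ≤ b + 1

/-- `mu` is an almost rectangular refinement of `lam`: the multiset of parts of
`mu` is a disjoint union of almost rectangular submultisets whose sums are
exactly the parts of `lam`. -/
def ARRefinement {n : ℕ} (lam mu : Nat.Partition n) : Prop :=
  ∃ pieces : Multiset (Multiset ℕ),
    pieces.sum = mu.parts ∧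
    pieces.map Multiset.sum = lam.parts ∧
    ∀ s ∈ pieces, AlmostRectangular s

/-- `M` is, up to a relabelling of the indices, the direct sum of the nilpotent Jordan blocks
whose sizes are the elements of `s`. -/
def IsRelabelledJordan {K α : Type*} [Field K] (M : Matrix α α K) (s : Multiset ℕ) : Prop :=
  ∃ (ι : Type) (_ : Fintype ι) (_ : DecidableEq ι) (f : ι → ℕ),
    Finset.univ.val.map f = s ∧
      ∃ e : ((i : ι) × Fin (f i)) ≃ α,
        M = Matrix.reindex e e (Matrix.blockDiagonal' fun i => jordanBlock K (f i))

/-- The `k`-th power of the nilpotent Jordan block of size `m`. -/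
def shiftMatrix (K : Type*) [Zero K] [One K] (m k : ℕ) : Matrix (Fin m) (Fin m) K :=
  Matrix.of fun i j => if (i : ℕ) + k = (j : ℕ) then 1 else 0

theorem shiftMatrix_mul {K : Type*} [Field K] (m k l : ℕ) :
    shiftMatrix K m k * shiftMatrix K m l = shiftMatrix K m (k + l) := by
  ext i j
  simp only [Matrix.mul_apply, shiftMatrix, Matrix.of_apply, ite_mul, one_mul, zero_mul]
  by_cases h : (i : ℕ) + k < m
  · rw [Finset.sum_eq_single (⟨i + k, h⟩ : Fin m)]
    · simp [add_assoc]
    · intro b _ hb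
      rw [if_neg]
      exact fun h' => hb (Fin.ext h'.symm)
    · simp
  · rw [if_neg (by omega)]
    exact Finset.sum_eq_zero fun b _ => if_neg (by omega)

theorem commute_shiftMatrix {K : Type*} [Field K] (m k l : ℕ) :
    Commute (shiftMatrix K m k) (shiftMatrix K m l) := by
  rw [Commute, SemiconjBy, shiftMatrix_mul, shiftMatrix_mul, add_comm]

theorem exists_eq_replicate_add_replicate (q : ℕ) (s : Multiset ℕ)
    (h : ∀ x ∈ s, x = q ∨ x = q + 1) :
    ∃ a b, s = Multiset.replicate a q + Multiset.replicate b (q + 1) := by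
  induction s using Multiset.induction with
  | empty => exact ⟨0, 0, by simp⟩
  | cons x s ih =>
    obtain ⟨a, b, hs⟩ := ih fun y hy => h y (Multiset.mem_cons_of_mem hy)
    rcases h x (Multiset.mem_cons_self x s) with hx | hx
    · exact ⟨a + 1, b, by rw [hs, hx, Multiset.replicate_succ, Multiset.cons_add]⟩
    · exact ⟨a, b + 1, by rw [hs, hx, Multiset.replicate_succ, Multiset.add_cons]⟩

theorem AlmostRectangular.eq_replicate {s : Multiset ℕ} (hs : AlmostRectangular s)
    (h0 : 0 < s.card) :
    s = Multiset.replicate (s.card - s.sum % s.card) (s.sum / s.card) +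
      Multiset.replicate (s.sum % s.card) (s.sum / s.card + 1) := by
  obtain ⟨q, hq, hmin⟩ : ∃ q ∈ s, ∀ x ∈ s, q ≤ x := by
    obtain ⟨y, hy⟩ := Multiset.card_pos_iff_exists_mem.mp h0
    have hex : ∃ q, q ∈ s := ⟨y, hy⟩
    classical
    exact ⟨Nat.find hex, Nat.find_spec hex, fun x hx => Nat.find_min' hex hx⟩
  obtain ⟨a, b, rfl⟩ := exists_eq_replicate_add_replicate q s fun x hx => by
    have := hs x hx q hq
    have := hmin x hx
    omega
  have ha : 0 < a := by
    rw [Multiset.mem_add, Multiset.mem_replicate, Multiset.mem_replicate] at hq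
    omega
  have hsum : (Multiset.replicate a q + Multiset.replicate b (q + 1)).sum = b + (a + b) * q := by
    simp; ring
  have hcard : (Multiset.replicate a q + Multiset.replicate b (q + 1)).card = a + b := by simp
  rw [hsum, hcard, Nat.add_mul_mod_self_left, Nat.mod_eq_of_lt (by omega),
    Nat.add_mul_div_left _ _ (by omega), Nat.div_eq_of_lt (by omega), Nat.add_sub_cancel, zero_add]

theorem AlmostRectangular.eq_of_card_eq_of_sum_eq {s t : Multiset ℕ} (hs : AlmostRectangular s)
    (ht : AlmostRectangular t) (hc : s.card = t.card) (hsum : s.sum = t.sum) : s = t := by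
  rcases Nat.eq_zero_or_pos s.card with h | h
  · exact (Multiset.card_eq_zero.mp h).trans (Multiset.card_eq_zero.mp (hc.symm.trans h)).symm
  · rw [hs.eq_replicate h, ht.eq_replicate (hc ▸ h), hc, hsum]

theorem isRelabelledJordan_shiftMatrix {K : Type*} [Field K] {s : Multiset ℕ}
    (hs : AlmostRectangular s) :
    IsRelabelledJordan (shiftMatrix K s.sum s.card) s := by
  set m := s.sum with hm
  set k := s.card with hk
  let f : Fin k → ℕ := fun r => (m + k - 1 - r) / k
  have hlt (r : Fin k) (q : ℕ) : q < f r ↔ q * k + r < m := by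
    have := r.2
    rw [Nat.lt_iff_add_one_le, Nat.le_div_iff_mul_le (by omega), add_mul]
    omega
  have hbij : Function.Bijective
      (fun x : (r : Fin k) × Fin (f r) => (⟨x.2 * k + x.1, (hlt _ _).1 x.2.2⟩ : Fin m)) := by
    constructor
    · rintro ⟨r, q, hq⟩ ⟨r', q', hq'⟩ h
      simp only [Fin.mk.injEq] at h
      have hr : r = r' := by
        have h1 := congrArg (· % k) h
        simp only [Nat.mul_add_mod_self_right, Nat.mod_eq_of_lt r.2, Nat.mod_eq_of_lt r'.2] at h1
        exact Fin.ext h1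
      subst hr
      have hq : q = q' := Nat.eq_of_mul_eq_mul_right (Nat.zero_lt_of_lt r.2) (by omega)
      subst hq
      rfl
    · intro a
      have hk0 : 0 < k := by
        rcases Nat.eq_zero_or_pos k with h | h
        · have hs0 : s = 0 := Multiset.card_eq_zero.mp h
          have h1 : m = 0 := by rw [hm, hs0, Multiset.sum_zero]
          have := a.2
          omega
        · exact h
      refine ⟨⟨⟨a % k, Nat.mod_lt _ hk0⟩, ⟨a / k, (hlt _ _).2 ?_⟩⟩, Fin.ext ?_⟩
      · simpa only [Nat.div_add_mod'] using a.2
      · exact Nat.div_add_mod' _ _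
  let e := Equiv.ofBijective _ hbij
  refine ⟨Fin k, inferInstance, inferInstance, f, ?_, e, ?_⟩
  · refine AlmostRectangular.eq_of_card_eq_of_sum_eq ?_ hs (by simp [hk]) ?_
    · intro a ha b hb
      obtain ⟨r, -, rfl⟩ := Multiset.mem_map.mp ha
      obtain ⟨r', -, rfl⟩ := Multiset.mem_map.mp hb
      have := r.2
      have := r'.2
      rw [← Nat.add_div_right _ (by omega)]
      exact Nat.div_le_div_right (by omega)
    · have h := Fintype.card_congr e
      simpa [List.sum_ofFn] using h
  · rw [← Equiv.symm_apply_eq]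
    ext ⟨r, q⟩ ⟨r', q'⟩
    simp only [Matrix.reindex_symm, Matrix.reindex_apply, Matrix.submatrix_apply,
      Equiv.symm_symm, shiftMatrix, Matrix.of_apply, e, Equiv.ofBijective_apply]
    by_cases hr : r = r'
    · subst hr
      rw [Matrix.blockDiagonal'_apply_eq, jordanBlock, Matrix.of_apply]
      refine if_congr ?_ rfl rfl
      have h1 : (q : ℕ) * k + r + k = (q' : ℕ) * k + r ↔ ((q : ℕ) + 1) * k = q' * k := by
        rw [add_mul]; omega
      rw [h1]
      exact ⟨Nat.eq_of_mul_eq_mul_right (Nat.zero_lt_of_lt r.2), fun h => by rw [h]⟩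
    · rw [Matrix.blockDiagonal'_apply_ne _ _ _ hr, if_neg]
      intro h
      have h1 := congrArg (· % k) h
      simp only [Nat.mul_add_mod_self_right, Nat.add_mod_right, Nat.mod_eq_of_lt r.2,
        Nat.mod_eq_of_lt r'.2] at h1
      exact hr (Fin.ext h1)

theorem IsRelabelledJordan.fromBlocks {K α β : Type*} [Field K] {M : Matrix α α K}
    {N : Matrix β β K} {s t : Multiset ℕ} (hM : IsRelabelledJordan M s)
    (hN : IsRelabelledJordan N t) :
    IsRelabelledJordan (Matrix.fromBlocks M 0 0 N) (s + t) := by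
  obtain ⟨ι, _, _, f, rfl, e, rfl⟩ := hM
  obtain ⟨κ, _, _, g, rfl, e', rfl⟩ := hN
  refine ⟨ι ⊕ κ, inferInstance, inferInstance, Sum.elim f g, ?_,
    (Equiv.sumSigmaDistrib _).trans (Equiv.sumCongr e e'), ?_⟩
  · simp [Finset.univ_disjSum_univ.symm, Finset.disjSum, Multiset.disjSum, Multiset.map_map]
  · rw [← Equiv.symm_apply_eq]
    ext ⟨i | i, a⟩ ⟨j | j, b⟩
    · by_cases h : i = j
      · subst h
        simp only [Matrix.blockDiagonal'_apply_eq]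
        simp [Equiv.sumSigmaDistrib]
        exact Matrix.blockDiagonal'_apply_eq _ _ _ _
      · simp [Equiv.sumSigmaDistrib, Matrix.blockDiagonal'_apply_ne, h]
        exact Matrix.blockDiagonal'_apply_ne _ _ _ h
    · simp [Equiv.sumSigmaDistrib, Matrix.blockDiagonal'_apply_ne]
    · simp [Equiv.sumSigmaDistrib, Matrix.blockDiagonal'_apply_ne]
    · by_cases h : i = j
      · subst h
        simp only [Matrix.blockDiagonal'_apply_eq]
        simp [Equiv.sumSigmaDistrib]
        exact Matrix.blockDiagonal'_apply_eq _ _ _ _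
      · simp [Equiv.sumSigmaDistrib, Matrix.blockDiagonal'_apply_ne, h]
        exact Matrix.blockDiagonal'_apply_ne _ _ _ h

theorem IsRelabelledJordan.card_eq {K α : Type*} [Field K] [Fintype α] {M : Matrix α α K}
    {s : Multiset ℕ} (hM : IsRelabelledJordan M s) : Fintype.card α = s.sum := by
  obtain ⟨ι, _, _, f, rfl, e, -⟩ := hM
  simpa using (Fintype.card_congr e).symm

theorem IsRelabelledJordan.hasJordanPartition {K α : Type*} [Field K] {n : ℕ}
    {M : Matrix α α K} {mu : Nat.Partition n} (hM : IsRelabelledJordan M mu.parts)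
    (c : α ≃ Fin n) : HasJordanPartition (Matrix.reindex c c M) mu := by
  obtain ⟨ι, _, _, f, hf, e, rfl⟩ := hM
  let L := List.ofFn (f ∘ (Fintype.equivFin ι).symm)
  have hlen : L.length = Fintype.card ι := List.length_ofFn
  let d : Fin L.length ≃ ι := (finCongr hlen).trans (Fintype.equivFin ι).symm
  have hget (i : Fin L.length) : L.get i = f (d i) := by simp [L, d]; rfl
  let u : ((i : Fin L.length) × Fin (L.get i)) ≃ ((i : ι) × Fin (f i)) :=
    Equiv.sigmaCongr d fun i => finCongr (hget i)
  refine ⟨L, ?_, (u.trans e).trans c, 1, ?_⟩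
  · rw [← hf, ← Finset.map_univ_equiv (Fintype.equivFin ι).symm]
    rw [Finset.map_val, Multiset.map_map]
    exact (Fin.univ_val_map _).symm
  · simp only [Units.val_one, one_mul, inv_one, mul_one]
    ext x y
    obtain ⟨⟨i, a⟩, rfl⟩ := ((u.trans e).trans c).surjective x
    obtain ⟨⟨j, b⟩, rfl⟩ := ((u.trans e).trans c).surjective y
    simp only [Matrix.reindex_apply, Matrix.submatrix_apply, Equiv.symm_apply_apply]
    simp only [Equiv.trans_apply, Equiv.symm_apply_apply]
    by_cases h : i = j
    · subst h
      simp [u, Equiv.sigmaCongr, Matrix.blockDiagonal'_apply_eq, jordanBlock]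
    · simp [u, Equiv.sigmaCongr, Matrix.blockDiagonal'_apply_ne, h]

theorem exists_commute_isRelabelledJordan (K : Type*) [Field K] {p q : Multiset (Multiset ℕ)}
    (h : Multiset.Rel
      (fun s t => s.sum = t.sum ∧ AlmostRectangular s ∧ AlmostRectangular t) p q) :
    ∃ (α : Type) (_ : Fintype α) (X Y : Matrix α α K),
      IsRelabelledJordan X p.sum ∧ IsRelabelledJordan Y q.sum ∧ Commute X Y := by
  induction h with
  | zero =>
    have h0 : IsRelabelledJordan (0 : Matrix (Fin 0) (Fin 0) K) (0 : Multiset (Multiset ℕ)).sum :=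
      ⟨Fin 0, inferInstance, inferInstance, Fin.elim0, by simp, Equiv.equivOfIsEmpty _ _,
        Subsingleton.elim _ _⟩
    exact ⟨Fin 0, inferInstance, 0, 0, h0, h0, Commute.refl 0⟩
  | @cons s t p q hst _ ih =>
    obtain ⟨α, _, X, Y, hX, hY, hXY⟩ := ih
    obtain ⟨hsum, hs, ht⟩ := hst
    rw [Multiset.sum_cons, Multiset.sum_cons, add_comm s, add_comm t]
    have hT := isRelabelledJordan_shiftMatrix (K := K) ht
    rw [← hsum] at hT
    refine ⟨α ⊕ Fin s.sum, inferInstance, _, _,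
      hX.fromBlocks (isRelabelledJordan_shiftMatrix hs), hY.fromBlocks hT, ?_⟩
    rw [Commute, SemiconjBy, Matrix.fromBlocks_multiply, Matrix.fromBlocks_multiply]
    simp [hXY.eq, (commute_shiftMatrix (K := K) s.sum s.card t.card).eq]

/-- Let `μ₁` and `μ₂` be partitions of `n`.  If some partition `λ` of `n` has
both `μ₁` and `μ₂` as almost rectangular refinements, then the nilpotent
similarity classes `N(μ₁)` and `N(μ₂)` commute over any field `K`. -/
theorem stmt12 {K : Type*} [Field K] {n : ℕ} (mu₁ mu₂ lam : Nat.Partition n)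
    (h1 : ARRefinement lam mu₁) (h2 : ARRefinement lam mu₂) :
    ∃ X Y : Matrix (Fin n) (Fin n) K,
      HasJordanPartition X mu₁ ∧ HasJordanPartition Y mu₂ ∧ Commute X Y := by
  obtain ⟨p, hp, hps, hpa⟩ := h1
  obtain ⟨q, hq, hqs, hqa⟩ := h2
  have hrel : Multiset.Rel
      (fun s t => s.sum = t.sum ∧ AlmostRectangular s ∧ AlmostRectangular t) p q := by
    have h := Multiset.rel_eq.mpr (hps.trans hqs.symm)
    rw [Multiset.rel_map] at h
    exact h.mono fun s hs t ht hst => ⟨hst, hpa s hs, hqa t ht⟩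
  obtain ⟨α, _, X, Y, hX, hY, hXY⟩ := exists_commute_isRelabelledJordan K hrel
  rw [hp] at hX
  rw [hq] at hY
  let c : α ≃ Fin n := Fintype.equivFinOfCardEq (hX.card_eq.trans mu₁.parts_sum)
  refine ⟨_, _, hX.hasJordanPartition c, hY.hasJordanPartition c, ?_⟩
  rw [Commute, SemiconjBy]
  simp only [Matrix.reindex_apply, Matrix.submatrix_mul_equiv, hXY.eq]
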